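/- For every PSST T = (Q_T, Σ, X, δ_T, τ_T, E_T, q_{0,T}, F_T) and every NFA A = (Q_A, Σ, δ_A, q_{0,A}, F_A), there exists an NFA B with at most |Q_T| · 2^{|X| · |Q_A|²} · 2^{k} · 2^{|Q_T|} states, where k is the number of ε-transitions of T (pairs (q, q') with q' occurring in τ_T(q)), such that L(B) = { w ∈ Σ* | T(w) is defined and T(w) ∈ L(A) }. -/

import Mathlib

open scoped BigOperators

/-- A prioritized streaming string transducer (PSST) over a finite alphabet `A`:
states `Q`, string variables `X`, prioritized non-ε transitions `δ` (a duplicate-free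
list of successor states, from highest to lowest priority), prioritized ε-transitions
`τ` (a pair of disjoint duplicate-free lists: those with higher resp. lower priority
than the non-ε transitions), variable-assignment functions `E` attached to transitions,
initial state `q0`, and partial output function `F`. -/
structure PSST (A : Type) [Fintype A] [DecidableEq A] : Type 1 where
  Q : Type
  fintypeQ : Fintype Q
  decEqQ : DecidableEq Q
  X : Type
  fintypeX : Fintype X
  decEqX : DecidableEq X
  δ : Q → A → List Q
  δ_nodup : ∀ q a, (δ q a).Nodup
  τ : Q → List Q × List Q
  τ₁_nodup : ∀ q, (τ q).1.Nodup
  τ₂_nodup : ∀ q, (τ q).2.Nodup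
  τ_disjoint : ∀ q q', q' ∈ (τ q).1 → q' ∉ (τ q).2
  E : Q → Option A → Q → X → List (X ⊕ A)
  q0 : Q
  F : Q → Option (List (X ⊕ A))

attribute [instance] PSST.fintypeQ PSST.decEqQ PSST.fintypeX PSST.decEqX

namespace PSST

variable {A : Type} [Fintype A] [DecidableEq A]

/-- `(q, a, q')` is a transition of `T` (`a = none` stands for ε). -/
def IsTrans (T : PSST A) (q : T.Q) (a : Option A) (q' : T.Q) : Prop :=
  match a with
  | some σ => q' ∈ T.δ q σ
  | none => q' ∈ (T.τ q).1 ∨ q' ∈ (T.τ q).2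

/-- Validity of a sequence of steps (letter-or-ε together with target state),
starting from state `q`. -/
def ValidFrom (T : PSST A) : T.Q → List (Option A × T.Q) → Prop
  | _, [] => True
  | q, (a, q') :: rest => T.IsTrans q a q' ∧ ValidFrom T q' rest

/-- The input word consumed by a sequence of steps. -/
def wordOf (T : PSST A) (steps : List (Option A × T.Q)) : List A :=
  steps.filterMap Prod.fst

/-- The state reached after the steps, starting from `q`. -/
def endState (T : PSST A) (q : T.Q) (steps : List (Option A × T.Q)) : T.Q :=
  (steps.map Prod.snd).getLastD q

/-- The list of transitions (source, letter-or-ε, target) along a sequence of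
steps starting from `q`. -/
def transList (T : PSST A) (q : T.Q) :
    List (Option A × T.Q) → List (T.Q × Option A × T.Q)
  | [] => []
  | (a, q') :: rest => (q, a, q') :: transList T q' rest

/-- Within every consecutive block of ε-transitions, no ε-transition occurs twice. -/
def NoEpsRepeat (T : PSST A) (tl : List (T.Q × Option A × T.Q)) : Prop :=
  ∀ (k l : ℕ) (t : T.Q × Option A × T.Q), k < l → tl[k]? = some t → tl[l]? = some t → t.2.1 = none →
    (∀ (m : ℕ) (t' : T.Q × Option A × T.Q), k ≤ m → m ≤ l → tl[m]? = some t' → t'.2.1 = none) → False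

/-- `steps` is a run of `T` on the input string `w`. -/
def IsRunOn (T : PSST A) (w : List A) (steps : List (Option A × T.Q)) : Prop :=
  T.ValidFrom T.q0 steps ∧ T.wordOf steps = w ∧
    T.NoEpsRepeat (T.transList T.q0 steps)

/-- `b` occurs strictly before `b'` in the list `l`. -/
def PrecIn {β : Type} (l : List β) (b b' : β) : Prop :=
  ∃ i j : ℕ, i < j ∧ l[i]? = some b ∧ l[j]? = some b'

/-- From state `q`, the first step has higher priority than the second one. -/
def StepPrec (T : PSST A) (q : T.Q) :
    Option A × T.Q → Option A × T.Q → Prop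
  | (some σ, q₁), (some σ', q₂) => σ = σ' ∧ PrecIn (T.δ q σ) q₁ q₂
  | (none, q₁), (none, q₂) =>
      PrecIn (T.τ q).1 q₁ q₂ ∨ PrecIn (T.τ q).2 q₁ q₂ ∨
        (q₁ ∈ (T.τ q).1 ∧ q₂ ∈ (T.τ q).2)
  | (none, q₁), (some σ, q₂) => q₁ ∈ (T.τ q).1 ∧ q₂ ∈ T.δ q σ
  | (some σ, q₁), (none, q₂) => q₁ ∈ T.δ q σ ∧ q₂ ∈ (T.τ q).2

/-- Run `R` is of higher priority than run `R'` (on the same input): either `R'` is a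
proper prefix of `R`, or at the first index where they differ the transition taken by
`R` precedes the one taken by `R'` in the priority order. -/
def HigherPriority (T : PSST A) (R R' : List (Option A × T.Q)) : Prop :=
  (R' <+: R ∧ R' ≠ R) ∨
    ∃ p s s' r r', R = p ++ s :: r ∧ R' = p ++ s' :: r' ∧ s ≠ s' ∧
      T.StepPrec (T.endState T.q0 p) s s'

/-- `R` is the accepting run of `T` on `w`: it ends in a state where `F` is defined
and has the highest priority among all such runs. -/
def IsAcceptingRunOn (T : PSST A) (w : List A)
    (R : List (Option A × T.Q)) : Prop :=
  T.IsRunOn w R ∧ (T.F (T.endState T.q0 R)).isSome ∧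
    ∀ R', T.IsRunOn w R' → (T.F (T.endState T.q0 R')).isSome → R' ≠ R →
      T.HigherPriority R R'

/-- Evaluate a word over `X ∪ A` under a valuation of the variables. -/
def evalWord (T : PSST A) (η : T.X → List A) (s : List (T.X ⊕ A)) : List A :=
  (s.map (fun c => match c with | Sum.inl x => η x | Sum.inr a => [a])).flatten

/-- The valuation of the variables obtained after executing the steps from state `q`,
starting from the valuation assigning ε to every variable. -/
def valAfter (T : PSST A) (q : T.Q) (steps : List (Option A × T.Q)) :
    T.X → List A :=
  (T.transList q steps).foldl
    (fun η t x => T.evalWord η (T.E t.1 t.2.1 t.2.2 x))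
    (fun _ => [])

/-- `T.Outputs w out` holds iff `T(w)` is defined and equals `out`, i.e. there is an
accepting run of `T` on `w` whose output evaluates to `out`. -/
def Outputs (T : PSST A) (w out : List A) : Prop :=
  ∃ R o, T.IsAcceptingRunOn w R ∧ T.F (T.endState T.q0 R) = some o ∧
    out = T.evalWord (T.valAfter T.q0 R) o

/-- The number of ε-transitions of `T`, i.e. of pairs `(q, q')` with `q'`
occurring in `τ q`. -/
def numEpsTransitions (T : PSST A) : ℕ :=
  ∑ q : T.Q, ((T.τ q).1.length + (T.τ q).2.length)

/-- `T` is copyless: in every transition, each variable occurs at most once in total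
among the right-hand sides of the variable assignments. -/
def Copyless (T : PSST A) : Prop :=
  ∀ q a q', T.IsTrans q a q' → ∀ x : T.X,
    (∑ x' : T.X, (T.E q a q' x').count (Sum.inl x)) ≤ 1

end PSST

/-- A language is regular iff it is accepted by some NFA with finitely many states. -/
def IsRegularLang {A : Type} [Fintype A] [DecidableEq A] (L : Language A) : Prop :=
  ∃ (σ : Type) (_ : Fintype σ) (M : NFA A σ), M.accepts = L

namespace PSST

variable {A : Type} [Fintype A] [DecidableEq A]

section Runs

variable (T : PSST A)

@[simp] theorem endState_nil (q : T.Q) : T.endState q [] = q := rfl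

@[simp] theorem endState_cons (q : T.Q) (s : Option A × T.Q) (r : List (Option A × T.Q)) :
    T.endState q (s :: r) = T.endState s.2 r := by
  simp only [endState, List.map_cons, List.getLastD_cons]

@[simp] theorem endState_append (q : T.Q) (r r' : List (Option A × T.Q)) :
    T.endState q (r ++ r') = T.endState (T.endState q r) r' := by
  induction r generalizing q with
  | nil => rfl
  | cons s r ih => simp [ih]

@[simp] theorem transList_append (q : T.Q) (r r' : List (Option A × T.Q)) :
    T.transList q (r ++ r') = T.transList q r ++ T.transList (T.endState q r) r' := by
  induction r generalizing q with
  | nil => rfl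
  | cons s r ih => simp [transList, ih]

@[simp] theorem validFrom_append (q : T.Q) (r r' : List (Option A × T.Q)) :
    T.ValidFrom q (r ++ r') ↔ T.ValidFrom q r ∧ T.ValidFrom (T.endState q r) r' := by
  induction r generalizing q with
  | nil => simp [ValidFrom]
  | cons s r ih => simp [ValidFrom, ih, and_assoc]

@[simp] theorem wordOf_append (r r' : List (Option A × T.Q)) :
    T.wordOf (r ++ r') = T.wordOf r ++ T.wordOf r' := by
  simp [wordOf]

theorem wordOf_eq_nil {r : List (Option A × T.Q)} :
    T.wordOf r = [] ↔ ∀ s ∈ r, s.1 = none := by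
  simp [wordOf, List.filterMap_eq_nil_iff]

theorem label_of_mem_transList {q : T.Q} {r : List (Option A × T.Q)}
    (hr : ∀ s ∈ r, s.1 = none) {t : T.Q × Option A × T.Q} (ht : t ∈ T.transList q r) :
    t.2.1 = none := by
  induction r generalizing q with
  | nil => simp [transList] at ht
  | cons s r ih =>
    simp only [transList, List.mem_cons] at ht
    rcases ht with rfl | ht
    · exact hr s (by simp)
    · exact ih (fun s hs => hr s (by simp [hs])) ht

variable {T}

theorem NoEpsRepeat.left {l m : List (T.Q × Option A × T.Q)}
    (h : T.NoEpsRepeat (l ++ m)) : T.NoEpsRepeat l := by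
  intro i j t hij hi hj ht hall
  have hjl : j < l.length := (List.getElem?_eq_some_iff.1 hj).1
  refine h i j t hij ?_ ?_ ht fun n t' hin hnj hn => hall n t' hin hnj ?_
  · rw [List.getElem?_append_left (by omega), hi]
  · rw [List.getElem?_append_left hjl, hj]
  · rwa [List.getElem?_append_left (by omega)] at hn

theorem NoEpsRepeat.right {l m : List (T.Q × Option A × T.Q)}
    (h : T.NoEpsRepeat (l ++ m)) : T.NoEpsRepeat m := by
  intro i j t hij hi hj ht hall
  refine h (l.length + i) (l.length + j) t (by omega) ?_ ?_ ht
    fun n t' hin hnj hn => hall (n - l.length) t' (by omega) (by omega) ?_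
  · rw [List.getElem?_append_right (by omega), Nat.add_sub_cancel_left, hi]
  · rw [List.getElem?_append_right (by omega), Nat.add_sub_cancel_left, hj]
  · rwa [List.getElem?_append_right (by omega)] at hn

theorem NoEpsRepeat.append_letter {l m : List (T.Q × Option A × T.Q)}
    {t : T.Q × Option A × T.Q} (hl : T.NoEpsRepeat l) (ht : t.2.1 ≠ none)
    (hm : T.NoEpsRepeat m) : T.NoEpsRepeat (l ++ t :: m) := by
  have hmid : (l ++ t :: m)[l.length]? = some t := by simp
  intro i j s hij hi hj hs hall
  by_cases hjl : j < l.length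
  · refine hl i j s hij ?_ ?_ hs fun n t' hin hnj hn => hall n t' hin hnj ?_
    · rwa [List.getElem?_append_left (by omega)] at hi
    · rwa [List.getElem?_append_left (by omega)] at hj
    · rwa [List.getElem?_append_left (by omega)]
  by_cases hil : i ≤ l.length
  · exact ht (hall l.length t hil (by omega) hmid)
  have key : ∀ n, (l ++ t :: m)[n + (l.length + 1)]? = m[n]? := fun n => by
    rw [List.getElem?_append_right (by omega),
      show n + (l.length + 1) - l.length = n + 1 by omega, List.getElem?_cons_succ]
  obtain ⟨i', rfl⟩ := Nat.exists_eq_add_of_le' (show l.length + 1 ≤ i by omega)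
  obtain ⟨j', rfl⟩ := Nat.exists_eq_add_of_le' (show l.length + 1 ≤ j by omega)
  rw [key] at hi hj
  exact hm i' j' s (by omega) hi hj hs fun n t' hin hnj hn =>
    hall (n + (l.length + 1)) t' (by omega) (by omega) ((key n).trans hn)

theorem noEpsRepeat_of_nodup {l : List (T.Q × Option A × T.Q)} (h : l.Nodup) :
    T.NoEpsRepeat l := by
  intro i j t hij hi hj _ _
  have hil := (List.getElem?_eq_some_iff.1 hi).1
  exact hij.ne ((List.getElem?_inj hil h).1 (hi.trans hj.symm))

theorem NoEpsRepeat.nodup {l : List (T.Q × Option A × T.Q)} (h : T.NoEpsRepeat l)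
    (hl : ∀ t ∈ l, t.2.1 = none) : l.Nodup := by
  rw [List.nodup_iff_getElem?_ne_getElem?]
  intro i j hij hj heq
  have hj' := List.getElem?_eq_getElem hj
  exact h i j l[j] hij (heq.trans hj') hj' (hl _ (List.getElem_mem hj))
    fun _ t' _ _ hn => hl t' (List.mem_of_getElem? hn)

variable (T)

/-- A sequence of ε-steps from `q` in which no transition occurs twice. -/
def EpsBlock (q : T.Q) (r : List (Option A × T.Q)) : Prop :=
  T.ValidFrom q r ∧ (∀ s ∈ r, s.1 = none) ∧ (T.transList q r).Nodup

/-- Runs on a word that end right after the last letter has been read. -/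
inductive LetterRun : List A → List (Option A × T.Q) → Prop
  | nil : LetterRun [] []
  | snoc {w : List A} {R r : List (Option A × T.Q)} {a : A} {q : T.Q} :
      LetterRun w R → T.EpsBlock (T.endState T.q0 R) r →
      q ∈ T.δ (T.endState (T.endState T.q0 R) r) a →
      LetterRun (w ++ [a]) (R ++ (r ++ [(some a, q)]))

variable {T}

theorem letterRun_nil_iff {R : List (Option A × T.Q)} : T.LetterRun [] R ↔ R = [] := by
  refine ⟨fun h => ?_, fun h => h ▸ .nil⟩
  generalize hw : ([] : List A) = w at h
  cases h with
  | nil => rfl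
  | snoc => simp at hw

theorem letterRun_snoc_iff {w : List A} {a : A} {R : List (Option A × T.Q)} :
    T.LetterRun (w ++ [a]) R ↔ ∃ R₀ r q, T.LetterRun w R₀ ∧
      T.EpsBlock (T.endState T.q0 R₀) r ∧ q ∈ T.δ (T.endState (T.endState T.q0 R₀) r) a ∧
      R = R₀ ++ (r ++ [(some a, q)]) := by
  constructor
  · intro h
    generalize hw : w ++ [a] = w' at h
    cases h with
    | nil => simp at hw
    | snoc h₁ h₂ h₃ =>
      obtain ⟨rfl, h⟩ := List.append_inj' hw rfl
      obtain rfl : a = _ := by simpa using h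
      exact ⟨_, _, _, h₁, h₂, h₃, rfl⟩
  · rintro ⟨R₀, r, q, h₁, h₂, h₃, rfl⟩
    exact .snoc h₁ h₂ h₃

theorem LetterRun.isRunOn_append {w : List A} {R : List (Option A × T.Q)}
    (h : T.LetterRun w R) {r : List (Option A × T.Q)}
    (hr : T.EpsBlock (T.endState T.q0 R) r) : T.IsRunOn w (R ++ r) := by
  induction h generalizing r with
  | nil => exact ⟨hr.1, T.wordOf_eq_nil.2 hr.2.1, noEpsRepeat_of_nodup hr.2.2⟩
  | @snoc w R r₀ a q h h₀ hq ih =>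
    obtain ⟨hv, hw, hn⟩ := ih h₀
    rw [← List.append_assoc] at hr ⊢
    refine ⟨?_, ?_, ?_⟩
    · rw [validFrom_append, validFrom_append]
      exact ⟨⟨hv, by simpa [ValidFrom, IsTrans] using hq⟩, hr.1⟩
    · rw [wordOf_append, wordOf_append, hw, T.wordOf_eq_nil.2 hr.2.1]
      simp [wordOf]
    · rw [List.append_assoc, List.singleton_append, transList_append, transList]
      refine hn.append_letter (by simp) (noEpsRepeat_of_nodup ?_)
      simpa using hr.2.2

theorem LetterRun.isRunOn {w : List A} {R : List (Option A × T.Q)}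
    (h : T.LetterRun w R) : T.IsRunOn w R := by
  simpa using h.isRunOn_append (r := []) ⟨trivial, by simp, by simp [transList]⟩

theorem isRunOn_iff {w : List A} {R : List (Option A × T.Q)} :
    T.IsRunOn w R ↔ ∃ R₀ r, T.LetterRun w R₀ ∧ T.EpsBlock (T.endState T.q0 R₀) r ∧
      R = R₀ ++ r := by
  refine ⟨fun h => ?_, fun ⟨R₀, r, h, hr, e⟩ => e ▸ h.isRunOn_append hr⟩
  induction R using List.reverseRecOn generalizing w with
  | nil =>
    obtain rfl : [] = w := h.2.1
    exact ⟨[], [], .nil, ⟨trivial, by simp, by simp [transList]⟩, rfl⟩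
  | append_singleton R s ih =>
    obtain ⟨hv, rfl, hn⟩ := h
    rw [validFrom_append] at hv
    rw [transList_append] at hn
    obtain ⟨R₀, r, h, hr, rfl⟩ := ih ⟨hv.1, rfl, hn.left⟩
    obtain ⟨_ | a, q⟩ := s
    · refine ⟨R₀, r ++ [(none, q)], by simpa [wordOf] using h, ⟨?_, ?_, ?_⟩, by simp⟩
      · rw [validFrom_append]
        exact ⟨hr.1, by simpa using hv.2⟩
      · simpa [or_imp, forall_and] using hr.2.1
      · rw [← transList_append, List.append_assoc, transList_append] at hn
        refine hn.right.nodup fun t ht => T.label_of_mem_transList ?_ ht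
        simpa [or_imp, forall_and] using hr.2.1
    · refine ⟨R₀ ++ (r ++ [(some a, q)]), [], ?_, ⟨trivial, by simp, by simp [transList]⟩,
        by simp⟩
      have hq : q ∈ T.δ (T.endState (T.endState T.q0 R₀) r) a := by
        simpa [ValidFrom, IsTrans] using hv.2
      have := h.snoc hr hq
      simpa [wordOf] using this

theorem LetterRun.eq_of_prefix {w : List A} {R R' : List (Option A × T.Q)}
    (h : T.LetterRun w R) (h' : T.LetterRun w R') (hp : R <+: R') : R = R' := by
  obtain ⟨z, rfl⟩ := hp
  have hz : ∀ s ∈ z, s.1 = none := by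
    have := h'.isRunOn.2.1
    rw [wordOf_append, h.isRunOn.2.1] at this
    exact T.wordOf_eq_nil.1 (by simpa using this)
  rcases List.eq_nil_or_concat z with rfl | ⟨z', s, rfl⟩
  · simp
  · generalize hR : R ++ z'.concat s = R' at h'
    cases h' with
    | nil => simp at hR
    | snoc _ _ _ =>
      simp only [List.concat_eq_append, ← List.append_assoc] at hR
      have hs := (List.append_inj' hR rfl).2
      simp only [List.cons.injEq, and_true] at hs
      have := hz s (by simp)
      simp [hs] at this

end Runs

section Priority

variable (T : PSST A)

/-- The priority order on step sequences from a common state, by recursion. -/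
def Higher : T.Q → List (Option A × T.Q) → List (Option A × T.Q) → Prop
  | _, [], _ => False
  | _, _ :: _, [] => True
  | q, s :: r, s' :: r' => (s = s' ∧ Higher s.2 r r') ∨ (s ≠ s' ∧ T.StepPrec q s s')

variable {T}

theorem higher_iff {q : T.Q} {R R' : List (Option A × T.Q)} :
    T.Higher q R R' ↔ (R' <+: R ∧ R' ≠ R) ∨
      ∃ p s s' r r', R = p ++ s :: r ∧ R' = p ++ s' :: r' ∧ s ≠ s' ∧
        T.StepPrec (T.endState q p) s s' := by
  induction R generalizing q R' with
  | nil => simp [Higher]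
  | cons s r ih =>
    cases R' with
    | nil => simp [Higher]
    | cons s' r' =>
      rw [Higher, ih]
      constructor
      · rintro (⟨rfl, ⟨h, hne⟩ | ⟨p, t, t', u, u', rfl, rfl, hne, ht⟩⟩ | ⟨hne, h⟩)
        · exact .inl ⟨by simpa using h, by simpa using hne⟩
        · exact .inr ⟨s :: p, t, t', u, u', rfl, rfl, hne, by simpa using ht⟩
        · exact .inr ⟨[], s, s', r, r', rfl, rfl, hne, h⟩
      · rintro (⟨h, hne⟩ | ⟨_ | ⟨v, p⟩, t, t', u, u', h, h', hne, ht⟩)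
        · obtain ⟨rfl, h'⟩ := List.cons_prefix_cons.1 h
          exact .inl ⟨rfl, .inl ⟨h', by simpa using hne⟩⟩
        · simp only [List.nil_append, List.cons.injEq] at h h'
          obtain ⟨rfl, rfl⟩ := h
          obtain ⟨rfl, rfl⟩ := h'
          exact .inr ⟨hne, ht⟩
        · simp only [List.cons_append, List.cons.injEq] at h h'
          obtain ⟨rfl, rfl⟩ := h
          obtain ⟨rfl, rfl⟩ := h'
          exact .inl ⟨rfl, .inr ⟨p, t, t', u, u', rfl, rfl, hne, by simpa using ht⟩⟩

theorem higherPriority_iff {R R' : List (Option A × T.Q)} :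
    T.HigherPriority R R' ↔ T.Higher T.q0 R R' :=
  higher_iff.symm

theorem higher_append_left {q : T.Q} {R u v : List (Option A × T.Q)} :
    T.Higher q (R ++ u) (R ++ v) ↔ T.Higher (T.endState q R) u v := by
  induction R generalizing q with
  | nil => rfl
  | cons s r ih => simp [Higher, ih]

theorem higher_append_append {q : T.Q} {R R' u v : List (Option A × T.Q)}
    (h : ¬ R <+: R') (h' : ¬ R' <+: R) :
    T.Higher q (R ++ u) (R' ++ v) ↔ T.Higher q R R' := by
  induction R generalizing q R' with
  | nil => simp at h
  | cons s r ih =>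
    cases R' with
    | nil => simp at h'
    | cons s' r' =>
      simp only [List.cons_append, Higher]
      refine or_congr_left (and_congr_right ?_)
      rintro rfl
      exact ih (by simpa using h) (by simpa using h')

theorem LetterRun.higher_append_iff {w : List A} {R R' : List (Option A × T.Q)}
    (h : T.LetterRun w R) (h' : T.LetterRun w R') (hne : R' ≠ R)
    (u v : List (Option A × T.Q)) :
    T.Higher T.q0 (R ++ u) (R' ++ v) ↔ T.Higher T.q0 R R' :=
  higher_append_append (fun hp => hne (h.eq_of_prefix h' hp).symm)
    (fun hp => hne (h'.eq_of_prefix h hp))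

theorem LetterRun.append_ne {w : List A} {R R' : List (Option A × T.Q)}
    (h : T.LetterRun w R) (h' : T.LetterRun w R') (hne : R' ≠ R)
    (u v : List (Option A × T.Q)) : R' ++ v ≠ R ++ u := by
  intro e
  rcases List.prefix_or_prefix_of_prefix (List.prefix_append R' v)
    (e ▸ List.prefix_append R u) with hp | hp
  · exact hne (h'.eq_of_prefix h hp)
  · exact hne (h.eq_of_prefix h' hp).symm

end Priority

section Abstraction

variable (T : PSST A) {S : Type} (N : NFA A S)

/-- The abstraction of a valuation: the transition relations of `N` induced by the
contents of the variables. -/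
def absVal (η : T.X → List A) : Set (T.X × S × S) :=
  {e | e.2.2 ∈ N.evalFrom {e.2.1} (η e.1)}

/-- The states of `N` reached from `U` along a word over variables and letters, where
the variables act by the relations in `ρ`. -/
def absEval (ρ : Set (T.X × S × S)) (U : Set S) (s : List (T.X ⊕ A)) : Set S :=
  s.foldl (fun V c => match c with
    | Sum.inl x => {t | ∃ u ∈ V, (x, u, t) ∈ ρ}
    | Sum.inr a => N.stepSet V a) U

/-- The effect of a sequence of transitions on abstracted valuations. -/
def absUpdate (ρ : Set (T.X × S × S)) (tl : List (T.Q × Option A × T.Q)) :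
    Set (T.X × S × S) :=
  tl.foldl (fun ρ t => {e | e.2.2 ∈ T.absEval N ρ {e.2.1} (T.E t.1 t.2.1 t.2.2 e.1)}) ρ

theorem absEval_absVal (η : T.X → List A) (U : Set S) (s : List (T.X ⊕ A)) :
    T.absEval N (T.absVal N η) U s = N.evalFrom U (T.evalWord η s) := by
  induction s generalizing U with
  | nil => rfl
  | cons c s ih =>
    rw [absEval, List.foldl_cons, ← absEval, ih]
    obtain x | a := c
    · simp only [evalWord, List.map_cons, List.flatten_cons, NFA.evalFrom_append]
      congr 1
      ext t
      rw [NFA.mem_evalFrom_iff_exists]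
      rfl
    · simp [evalWord]

theorem absUpdate_absVal (η : T.X → List A) (tl : List (T.Q × Option A × T.Q)) :
    T.absUpdate N (T.absVal N η) tl =
      T.absVal N (tl.foldl (fun η t x => T.evalWord η (T.E t.1 t.2.1 t.2.2 x)) η) := by
  induction tl generalizing η with
  | nil => rfl
  | cons t tl ih =>
    rw [absUpdate, List.foldl_cons, ← absUpdate, List.foldl_cons, ← ih]
    congr 1
    ext e
    rw [Set.mem_ofPred_eq, absEval_absVal]
    rfl

theorem absVal_valAfter_append (q : T.Q) (r r' : List (Option A × T.Q)) :
    T.absVal N (T.valAfter q (r ++ r')) =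
      T.absUpdate N (T.absVal N (T.valAfter q r)) (T.transList (T.endState q r) r') := by
  rw [absUpdate_absVal, valAfter, transList_append, List.foldl_append, ← valAfter]

end Abstraction

section Preimage

variable (T : PSST A) {S : Type} (N : NFA A S)

/-- The states that compete with the chosen run after reading `a`: `U` are the competitors
before, the chosen run is in `q`, and continues with `r`. -/
def nextRivals (q : T.Q) (U : Set T.Q) (a : A) (r : List (Option A × T.Q)) : Set T.Q :=
  {p' | (∃ p ∈ U, ∃ r', T.EpsBlock p r' ∧ p' ∈ T.δ (T.endState p r') a) ∨
    ∃ r', T.EpsBlock q r' ∧ p' ∈ T.δ (T.endState q r') a ∧ r' ++ [(some a, p')] ≠ r ∧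
      ¬ T.Higher q r (r' ++ [(some a, p')])}

/-- The automaton for the pre-image of `N.accepts` under `T`. It guesses a run of `T`, one
block of ε-steps and one letter at a time, and tracks the state of that run, the abstracted
valuation, and the states of all runs that the guessed run does not take priority over. -/
def preimageNFA : NFA A (T.Q × Set (T.X × S × S) × Set T.Q) where
  start := {(T.q0, T.absVal N fun _ => [], ∅)}
  step c a := {c' | ∃ r q, T.EpsBlock c.1 r ∧ q ∈ T.δ (T.endState c.1 r) a ∧
    c' = (q, T.absUpdate N c.2.1 (T.transList c.1 (r ++ [(some a, q)])),
      T.nextRivals c.1 c.2.2 a (r ++ [(some a, q)]))}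
  accept := {c | ∃ r o, T.EpsBlock c.1 r ∧ T.F (T.endState c.1 r) = some o ∧
    (∃ t ∈ N.accept, t ∈ T.absEval N (T.absUpdate N c.2.1 (T.transList c.1 r)) N.start o) ∧
    (∀ p ∈ c.2.2, ∀ r', T.EpsBlock p r' → ¬ (T.F (T.endState p r')).isSome) ∧
    ∀ r', T.EpsBlock c.1 r' → (T.F (T.endState c.1 r')).isSome → r' ≠ r →
      T.Higher c.1 r r'}

/-- The end states of the runs on `w` that `R` does not take priority over. -/
def rivals (w : List A) (R : List (Option A × T.Q)) : Set T.Q :=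
  {p | ∃ R', T.LetterRun w R' ∧ R' ≠ R ∧ ¬ T.Higher T.q0 R R' ∧ T.endState T.q0 R' = p}

/-- The state of `T.preimageNFA N` that represents the run `R` on `w`. -/
def config (w : List A) (R : List (Option A × T.Q)) : T.Q × Set (T.X × S × S) × Set T.Q :=
  (T.endState T.q0 R, T.absVal N (T.valAfter T.q0 R), T.rivals w R)

variable {T}

theorem LetterRun.rivals_append {w : List A} {R : List (Option A × T.Q)}
    (h : T.LetterRun w R) (a : A) (r : List (Option A × T.Q)) :
    T.rivals (w ++ [a]) (R ++ r) =
      T.nextRivals (T.endState T.q0 R) (T.rivals w R) a r := by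
  ext p'
  constructor
  · rintro ⟨R₁, h₁, hne, hnot, rfl⟩
    obtain ⟨R', r', q, h', hr', hq, rfl⟩ := letterRun_snoc_iff.1 h₁
    by_cases hR : R' = R
    · subst hR
      rw [higher_append_left] at hnot
      exact .inr ⟨r', hr', by simpa using hq, by simpa using hne, by simpa using hnot⟩
    · rw [h.higher_append_iff h' hR] at hnot
      exact .inl ⟨_, ⟨R', h', hR, hnot, rfl⟩, r', hr', by simpa using hq⟩
  · rintro (⟨_, ⟨R', h', hR, hnot, rfl⟩, r', hr', hq⟩ | ⟨r', hr', hq, hne, hnot⟩)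
    · refine ⟨_, h'.snoc hr' hq, h.append_ne h' hR _ _, ?_, by simp⟩
      rwa [h.higher_append_iff h' hR]
    · refine ⟨_, h.snoc hr' hq, by simpa using hne, ?_, by simp⟩
      rwa [higher_append_left]

theorem mem_eval_preimageNFA {w : List A} {c : T.Q × Set (T.X × S × S) × Set T.Q} :
    c ∈ (T.preimageNFA N).eval w ↔ ∃ R, T.LetterRun w R ∧ c = T.config N w R := by
  induction w using List.reverseRecOn generalizing c with
  | nil =>
    have : T.rivals [] [] = ∅ := by
      ext p
      simp +contextual [rivals, letterRun_nil_iff]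
    simp [letterRun_nil_iff, preimageNFA, config, this, valAfter, transList]
  | append_singleton w a ih =>
    have key : ∀ {R r q}, T.LetterRun w R →
        T.config N (w ++ [a]) (R ++ (r ++ [(some a, q)])) =
          (q, T.absUpdate N (T.config N w R).2.1
            (T.transList (T.config N w R).1 (r ++ [(some a, q)])),
            T.nextRivals (T.config N w R).1 (T.config N w R).2.2 a (r ++ [(some a, q)])) := by
      intro R r q h
      rw [config, h.rivals_append, absVal_valAfter_append]
      simp [config]
    rw [NFA.eval_append_singleton, NFA.mem_stepSet]
    constructor
    · rintro ⟨c₀, hc₀, r, q, hr, hq, rfl⟩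
      obtain ⟨R, h, rfl⟩ := ih.1 hc₀
      exact ⟨_, h.snoc hr hq, (key h).symm⟩
    · rintro ⟨R₁, h₁, rfl⟩
      obtain ⟨R, r, q, h, hr, hq, rfl⟩ := letterRun_snoc_iff.1 h₁
      exact ⟨_, ih.2 ⟨R, h, rfl⟩, r, q, hr, hq, key h⟩

theorem LetterRun.isAcceptingRunOn_append_iff {w : List A} {R r : List (Option A × T.Q)}
    (h : T.LetterRun w R) (hr : T.EpsBlock (T.endState T.q0 R) r)
    (hF : (T.F (T.endState (T.endState T.q0 R) r)).isSome) :
    T.IsAcceptingRunOn w (R ++ r) ↔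
      (∀ p ∈ T.rivals w R, ∀ r', T.EpsBlock p r' → ¬ (T.F (T.endState p r')).isSome) ∧
      ∀ r', T.EpsBlock (T.endState T.q0 R) r' →
        (T.F (T.endState (T.endState T.q0 R) r')).isSome → r' ≠ r →
          T.Higher (T.endState T.q0 R) r r' := by
  constructor
  · rintro ⟨-, -, hmax⟩
    constructor
    · rintro _ ⟨R', h', hR, hnot, rfl⟩ r' hr' hF'
      have := hmax _ (h'.isRunOn_append hr') (by simpa using hF') (h.append_ne h' hR _ _)
      rw [higherPriority_iff, h.higher_append_iff h' hR] at this
      exact hnot this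
    · intro r' hr' hF' hne
      have := hmax _ (h.isRunOn_append hr') (by simpa using hF') (by simpa using hne)
      rwa [higherPriority_iff, higher_append_left] at this
  · rintro ⟨hriv, hblock⟩
    refine ⟨h.isRunOn_append hr, by simpa using hF, fun R₁ h₁ hF₁ hne => ?_⟩
    obtain ⟨R', r', h', hr', rfl⟩ := isRunOn_iff.1 h₁
    rw [endState_append] at hF₁
    rw [higherPriority_iff]
    by_cases hR : R' = R
    · subst hR
      rw [higher_append_left]
      exact hblock r' hr' hF₁ (by simpa using hne)
    · rw [h.higher_append_iff h' hR]
      by_contra hnot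
      exact hriv _ ⟨R', h', hR, hnot, rfl⟩ r' hr' hF₁

theorem config_mem_accept_iff {w : List A} {R : List (Option A × T.Q)}
    (h : T.LetterRun w R) :
    T.config N w R ∈ (T.preimageNFA N).accept ↔
      ∃ r o, T.EpsBlock (T.endState T.q0 R) r ∧
        T.F (T.endState T.q0 (R ++ r)) = some o ∧
        T.evalWord (T.valAfter T.q0 (R ++ r)) o ∈ N.accepts ∧
        T.IsAcceptingRunOn w (R ++ r) := by
  refine exists_congr fun r => exists_congr fun o => and_congr_right fun hr => ?_
  rw [endState_append]
  refine and_congr_right fun hF => and_congr ?_ ?_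
  · simp only [config]
    rw [← absVal_valAfter_append, absEval_absVal]
    rfl
  · exact (h.isAcceptingRunOn_append_iff hr (Option.isSome_iff_exists.2 ⟨o, hF⟩)).symm

theorem accepts_preimageNFA :
    (T.preimageNFA N).accepts = {w : List A | ∃ out, T.Outputs w out ∧ out ∈ N.accepts} := by
  ext w
  have : w ∈ (T.preimageNFA N).accepts ↔
      ∃ c ∈ (T.preimageNFA N).accept, c ∈ (T.preimageNFA N).eval w := Iff.rfl
  rw [this]
  constructor
  · rintro ⟨c, hacc, hc⟩
    obtain ⟨R, h, rfl⟩ := (mem_eval_preimageNFA N).1 hc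
    obtain ⟨r, o, -, hF, ho, hR⟩ := (config_mem_accept_iff N h).1 hacc
    exact ⟨_, ⟨_, o, hR, hF, rfl⟩, ho⟩
  · rintro ⟨_, ⟨R₁, o, hR, hF, rfl⟩, ho⟩
    obtain ⟨R, r, h, hr, rfl⟩ := isRunOn_iff.1 hR.1
    exact ⟨_, (config_mem_accept_iff N h).2 ⟨r, o, hr, hF, ho, hR⟩,
      (mem_eval_preimageNFA N).2 ⟨R, h, rfl⟩⟩

end Preimage

end PSST

/-- Pre-image of a regular language under a PSST, with a bound on the automaton size:
for every PSST `T` and NFA `A` (with ε-transitions and a single initial state), there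
is an NFA `B` with at most `|Q_T| · 2^(|X|·|Q_A|²) · 2^k · 2^(|Q_T|)` states, `k` being
the number of ε-transitions of `T`, accepting exactly
`{ w | T(w) is defined and T(w) ∈ L(A) }`. -/
theorem psst_preimage_nfa_bound {A : Type} [Fintype A] [DecidableEq A]
    (T : PSST A) (QA : Type) [Fintype QA] (M : εNFA A QA) (q0A : QA)
    (hstart : M.start = {q0A}) :
    ∃ (QB : Type) (_ : Fintype QB) (B : εNFA A QB) (q0B : QB),
      B.start = {q0B} ∧
      Fintype.card QB ≤
        Fintype.card T.Q * 2 ^ (Fintype.card T.X * Fintype.card QA ^ 2) *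
          2 ^ T.numEpsTransitions * 2 ^ Fintype.card T.Q ∧
      B.accepts = { w : List A | ∃ out, T.Outputs w out ∧ out ∈ M.accepts } := by
  classical
  refine ⟨_, inferInstance, (T.preimageNFA M.toNFA).toεNFA, _, rfl, ?_, ?_⟩
  · rw [Fintype.card_prod, Fintype.card_prod, Fintype.card_set, Fintype.card_set,
      Fintype.card_prod, Fintype.card_prod, ← sq, ← mul_assoc]
    exact Nat.mul_le_mul_right _ (Nat.le_mul_of_pos_right _ (by positivity))
  · rw [NFA.toεNFA_correct, PSST.accepts_preimageNFA, M.toNFA_correct]
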